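/- There exists D > 0 depending only on C₀ such that the following holds: if ε, β > 0 satisfy β ≤ D²ε⁴ and u is an admissible solution of (★) whose initial datum satisfies the data bounds with constant C₀, then there is a constant C depending only on C₀ such that for every t > 0: β ∫₀ᵗ ∫_ℝ |∂_x u(s,x)| · |∂_x² u(s,x)| dx ds ≤ C ε². -/

import Mathlib

open MeasureTheory Real Filter Set

noncomputable section

/-- `mixedD u j k t x`: `j` time derivatives of the `k`-th spatial derivative of `u` at `(t,x)`. -/
def mixedD (u : ℝ → ℝ → ℝ) (j k : ℕ) (t x : ℝ) : ℝ :=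
  iteratedDeriv j (fun s => iteratedDeriv k (fun y => u s y) x) t

/-- Squared `L²` norm in the space variable. -/
def sqL2 (f : ℝ → ℝ) : ℝ := ∫ x : ℝ, (f x) ^ 2

/-- `L²` norm in the space variable. -/
def nL2 (f : ℝ → ℝ) : ℝ := Real.sqrt (∫ x : ℝ, (f x) ^ 2)

/-- `L⁴` norm in the space variable. -/
def nL4 (f : ℝ → ℝ) : ℝ := (∫ x : ℝ, (f x) ^ 4) ^ ((1 : ℝ) / 4)

/-- Admissible solution of the Rosenau–KdV–RLW approximation (★). -/
structure IsAdmissibleKdVRLW (ε β : ℝ) (u : ℝ → ℝ → ℝ) : Prop where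
  smooth : ContDiff ℝ (⊤ : ℕ∞) (fun p : ℝ × ℝ => u p.1 p.2)
  pde : ∀ t > (0 : ℝ), ∀ x : ℝ,
    mixedD u 1 0 t x + deriv (fun y => (u t y) ^ 2) x
      + β * mixedD u 0 3 t x - β * mixedD u 1 2 t x
      + β ^ 2 * mixedD u 1 4 t x = ε * mixedD u 0 2 t x
  sq_int : ∀ T > (0 : ℝ), ∀ j k : ℕ, j + k ≤ 5 → ∀ t ∈ Set.Icc (0 : ℝ) T,
    MeasureTheory.Integrable (fun x : ℝ => (mixedD u j k t x) ^ 2)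
  decay : ∀ T > (0 : ℝ), ∀ j k : ℕ, j + k ≤ 5 → ∀ δ > (0 : ℝ), ∃ M : ℝ,
    ∀ x : ℝ, M ≤ |x| → ∀ t ∈ Set.Icc (0 : ℝ) T, |mixedD u j k t x| ≤ δ

/-- Admissible solution of the Rosenau–RLW approximation (★★). -/
structure IsAdmissibleRLW (ε β : ℝ) (u : ℝ → ℝ → ℝ) : Prop where
  smooth : ContDiff ℝ (⊤ : ℕ∞) (fun p : ℝ × ℝ => u p.1 p.2)
  pde : ∀ t > (0 : ℝ), ∀ x : ℝ,
    mixedD u 1 0 t x + deriv (fun y => (u t y) ^ 2) x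
      - β * mixedD u 1 2 t x + β ^ 2 * mixedD u 1 4 t x = ε * mixedD u 0 2 t x
  sq_int : ∀ T > (0 : ℝ), ∀ j k : ℕ, j + k ≤ 5 → ∀ t ∈ Set.Icc (0 : ℝ) T,
    MeasureTheory.Integrable (fun x : ℝ => (mixedD u j k t x) ^ 2)
  decay : ∀ T > (0 : ℝ), ∀ j k : ℕ, j + k ≤ 5 → ∀ δ > (0 : ℝ), ∃ M : ℝ,
    ∀ x : ℝ, M ≤ |x| → ∀ t ∈ Set.Icc (0 : ℝ) T, |mixedD u j k t x| ≤ δ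

/-- Data bounds with constant `C0` for the (★) approximation. -/
def DataBoundsKdVRLW (ε β C0 : ℝ) (f : ℝ → ℝ) : Prop :=
  (∫ x : ℝ, (f x) ^ 2) + (∫ x : ℝ, (f x) ^ 4)
      + (β + ε ^ 2) * (∫ x : ℝ, (deriv f x) ^ 2) ≤ C0 ∧
  (β * ε + β * ε ^ 2 + β ^ 2) * (∫ x : ℝ, (iteratedDeriv 2 f x) ^ 2)
      + (β ^ 2 * ε ^ 2 + β ^ 3) * (∫ x : ℝ, (iteratedDeriv 3 f x) ^ 2) ≤ C0 ∧
  β ^ 4 * (∫ x : ℝ, (iteratedDeriv 4 f x) ^ 2) ≤ C0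

/-- Data bounds with constant `C0` for the (★★) approximation. -/
def DataBoundsRLW (ε β C0 : ℝ) (f : ℝ → ℝ) : Prop :=
  (∫ x : ℝ, (f x) ^ 2) + (∫ x : ℝ, (f x) ^ 4)
    + β * ε ^ 2 * (∫ x : ℝ, (iteratedDeriv 2 f x) ^ 2) ≤ C0

/-- `u ∈ L^∞((0,∞); L²(ℝ) ∩ L⁴(ℝ))`. -/
def BddL2L4 (u : ℝ → ℝ → ℝ) : Prop :=
  ∃ M : ℝ, ∀ t > (0 : ℝ), (∫ x : ℝ, (u t x) ^ 2) ≤ M ∧ (∫ x : ℝ, (u t x) ^ 4) ≤ M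

/-- Entropy solution of `∂ₜ u + ∂ₓ (u²) = 0` with initial datum `u0`. -/
def IsEntropySolution (u : ℝ → ℝ → ℝ) (u0 : ℝ → ℝ) : Prop :=
  ∀ η : ℝ → ℝ, ContDiff ℝ 2 η → ConvexOn ℝ Set.univ η →
    (∃ M : ℝ, ∀ v : ℝ, |deriv η v| ≤ M) →
    ∀ φ : ℝ → ℝ → ℝ, ContDiff ℝ (⊤ : ℕ∞) (fun p : ℝ × ℝ => φ p.1 p.2) →
      HasCompactSupport (fun p : ℝ × ℝ => φ p.1 p.2) →
      (∀ t x : ℝ, 0 ≤ φ t x) →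
      0 ≤ (∫ t in Set.Ioi (0 : ℝ), ∫ x : ℝ,
            (η (u t x) * deriv (fun s => φ s x) t
              + (∫ ξ in (0 : ℝ)..(u t x), 2 * ξ * deriv η ξ) * deriv (fun y => φ t y) x))
          + ∫ x : ℝ, η (u0 x) * φ 0 x

/-! ### Mixed partial derivatives of smooth functions of two variables -/

/-- Partial derivative in the time variable. -/
def timeD (f : ℝ × ℝ → ℝ) (p : ℝ × ℝ) : ℝ := fderiv ℝ f p (1, 0)

/-- Partial derivative in the space variable. -/
def spaceD (f : ℝ × ℝ → ℝ) (p : ℝ × ℝ) : ℝ := fderiv ℝ f p (0, 1)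

lemma contDiff_fderiv_apply_const {f : ℝ × ℝ → ℝ} (hf : ContDiff ℝ (⊤ : ℕ∞) f) (v : ℝ × ℝ) :
    ContDiff ℝ (⊤ : ℕ∞) (fun p => fderiv ℝ f p v) :=
  (hf.fderiv_right (m := ((⊤ : ℕ∞) : WithTop ℕ∞)) le_rfl).clm_apply contDiff_const

lemma contDiff_timeD {f : ℝ × ℝ → ℝ} (hf : ContDiff ℝ (⊤ : ℕ∞) f) :
    ContDiff ℝ (⊤ : ℕ∞) (timeD f) :=
  contDiff_fderiv_apply_const hf _

lemma contDiff_spaceD {f : ℝ × ℝ → ℝ} (hf : ContDiff ℝ (⊤ : ℕ∞) f) :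
    ContDiff ℝ (⊤ : ℕ∞) (spaceD f) :=
  contDiff_fderiv_apply_const hf _

lemma contDiff_iterate_timeD {f : ℝ × ℝ → ℝ} (hf : ContDiff ℝ (⊤ : ℕ∞) f) (j : ℕ) :
    ContDiff ℝ (⊤ : ℕ∞) (timeD^[j] f) := by
  induction j with
  | zero => exact hf
  | succ j ih => rw [Function.iterate_succ_apply']; exact contDiff_timeD ih

lemma contDiff_iterate_spaceD {f : ℝ × ℝ → ℝ} (hf : ContDiff ℝ (⊤ : ℕ∞) f) (k : ℕ) :
    ContDiff ℝ (⊤ : ℕ∞) (spaceD^[k] f) := by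
  induction k with
  | zero => exact hf
  | succ k ih => rw [Function.iterate_succ_apply']; exact contDiff_spaceD ih

lemma hasDerivAt_timeD {f : ℝ × ℝ → ℝ} (hf : ContDiff ℝ (⊤ : ℕ∞) f) (t x : ℝ) :
    HasDerivAt (fun s => f (s, x)) (timeD f (t, x)) t :=
  ((hf.differentiable (by simp)) (t, x)).hasFDerivAt.comp_hasDerivAt t
    ((hasDerivAt_id t).prodMk (hasDerivAt_const t x))

lemma hasDerivAt_spaceD {f : ℝ × ℝ → ℝ} (hf : ContDiff ℝ (⊤ : ℕ∞) f) (t x : ℝ) :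
    HasDerivAt (fun y => f (t, y)) (spaceD f (t, x)) x :=
  ((hf.differentiable (by simp)) (t, x)).hasFDerivAt.comp_hasDerivAt x
    ((hasDerivAt_const x t).prodMk (hasDerivAt_id x))

lemma fderiv_fderiv_apply {f : ℝ × ℝ → ℝ} (hf : ContDiff ℝ (⊤ : ℕ∞) f) (p v w : ℝ × ℝ) :
    fderiv ℝ (fun q => fderiv ℝ f q v) p w = fderiv ℝ (fderiv ℝ f) p w v := by
  have h : DifferentiableAt ℝ (fderiv ℝ f) p :=
    ((hf.fderiv_right (m := ((⊤ : ℕ∞) : WithTop ℕ∞)) le_rfl).differentiable (by simp)) p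
  have := (h.hasFDerivAt.clm_apply (hasFDerivAt_const v p)).fderiv
  rw [this]
  simp

lemma spaceD_timeD {f : ℝ × ℝ → ℝ} (hf : ContDiff ℝ (⊤ : ℕ∞) f) :
    spaceD (timeD f) = timeD (spaceD f) := by
  funext p
  have hsymm : IsSymmSndFDerivAt ℝ f p :=
    hf.contDiffAt.isSymmSndFDerivAt (by
      simp only [minSmoothness_of_isRCLikeNormedField]
      exact WithTop.coe_le_coe.2 (le_top : (2 : ℕ∞) ≤ ⊤))
  exact (fderiv_fderiv_apply hf p (1, 0) (0, 1)).trans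
    ((hsymm _ _).trans (fderiv_fderiv_apply hf p (0, 1) (1, 0)).symm)

lemma spaceD_iterate_timeD {f : ℝ × ℝ → ℝ} (hf : ContDiff ℝ (⊤ : ℕ∞) f) (j : ℕ) :
    spaceD (timeD^[j] f) = timeD^[j] (spaceD f) := by
  induction j with
  | zero => rfl
  | succ j ih =>
    rw [Function.iterate_succ_apply', Function.iterate_succ_apply',
      spaceD_timeD (contDiff_iterate_timeD hf j), ih]

lemma iteratedDeriv_space {f : ℝ × ℝ → ℝ} (hf : ContDiff ℝ (⊤ : ℕ∞) f) (k : ℕ) (t x : ℝ) :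
    iteratedDeriv k (fun y => f (t, y)) x = (spaceD^[k] f) (t, x) := by
  induction k generalizing x with
  | zero => simp
  | succ k ih =>
    rw [iteratedDeriv_succ, funext ih, Function.iterate_succ_apply']
    exact (hasDerivAt_spaceD (contDiff_iterate_spaceD hf k) t x).deriv

lemma iteratedDeriv_time {f : ℝ × ℝ → ℝ} (hf : ContDiff ℝ (⊤ : ℕ∞) f) (j : ℕ) (t x : ℝ) :
    iteratedDeriv j (fun s => f (s, x)) t = (timeD^[j] f) (t, x) := by
  induction j generalizing t with
  | zero => simp
  | succ j ih =>
    rw [iteratedDeriv_succ, funext ih, Function.iterate_succ_apply']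
    exact (hasDerivAt_timeD (contDiff_iterate_timeD hf j) t x).deriv

lemma mixedD_eq {u : ℝ → ℝ → ℝ}
    (hu : ContDiff ℝ (⊤ : ℕ∞) (fun p : ℝ × ℝ => u p.1 p.2)) (j k : ℕ) (t x : ℝ) :
    mixedD u j k t x = (timeD^[j] (spaceD^[k] fun p : ℝ × ℝ => u p.1 p.2)) (t, x) := by
  rw [← iteratedDeriv_time (contDiff_iterate_spaceD hu k) j t x, mixedD]
  congr 1
  funext s
  exact iteratedDeriv_space hu k s x

lemma continuous_mixedD {u : ℝ → ℝ → ℝ}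
    (hu : ContDiff ℝ (⊤ : ℕ∞) (fun p : ℝ × ℝ => u p.1 p.2)) (j k : ℕ) :
    Continuous (fun p : ℝ × ℝ => mixedD u j k p.1 p.2) := by
  simp only [mixedD_eq hu]
  exact (contDiff_iterate_timeD (contDiff_iterate_spaceD hu k) j).continuous

lemma hasDerivAt_mixedD_time {u : ℝ → ℝ → ℝ}
    (hu : ContDiff ℝ (⊤ : ℕ∞) (fun p : ℝ × ℝ => u p.1 p.2)) (j k : ℕ) (t x : ℝ) :
    HasDerivAt (fun s => mixedD u j k s x) (mixedD u (j + 1) k t x) t := by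
  simp only [mixedD_eq hu, Function.iterate_succ_apply']
  exact hasDerivAt_timeD (contDiff_iterate_timeD (contDiff_iterate_spaceD hu k) j) t x

lemma hasDerivAt_mixedD_space {u : ℝ → ℝ → ℝ}
    (hu : ContDiff ℝ (⊤ : ℕ∞) (fun p : ℝ × ℝ => u p.1 p.2)) (j k : ℕ) (t x : ℝ) :
    HasDerivAt (fun y => mixedD u j k t y) (mixedD u j (k + 1) t x) x := by
  simp only [mixedD_eq hu, Function.iterate_succ_apply' spaceD,
    ← spaceD_iterate_timeD (contDiff_iterate_spaceD hu k)]
  exact hasDerivAt_spaceD (contDiff_iterate_timeD (contDiff_iterate_spaceD hu k) j) t x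

/-! ### Local balance laws and their integrated form -/

lemma intervalIntegrable_of_continuous_uncurry {f : ℝ → ℝ → ℝ}
    (hf : Continuous (fun p : ℝ × ℝ => f p.1 p.2)) (s a b : ℝ) :
    IntervalIntegrable (f s) volume a b :=
  (hf.comp (Continuous.prodMk_right s)).intervalIntegrable a b

lemma continuous_intervalIntegral_snd {f : ℝ → ℝ → ℝ}
    (hf : Continuous (fun p : ℝ × ℝ => f p.1 p.2)) (a b : ℝ) :
    Continuous (fun s => ∫ x in a..b, f s x) :=
  intervalIntegral.continuous_parametric_intervalIntegral_of_continuous' (f := f) hf a b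

lemma intervalIntegral_swap_of_continuous {f : ℝ → ℝ → ℝ}
    (hf : Continuous (fun p : ℝ × ℝ => f p.1 p.2)) (a b c d : ℝ) :
    ∫ x in a..b, ∫ s in c..d, f s x = ∫ s in c..d, ∫ x in a..b, f s x := by
  refine intervalIntegral_intervalIntegral_swap (F := fun x s => f s x) ?_
  refine IntegrableOn.mono_set (t := Set.uIcc a b ×ˢ Set.uIcc c d) ?_
    (Set.prod_mono Set.uIoc_subset_uIcc Set.uIoc_subset_uIcc)
  exact ContinuousOn.integrableOn_compact (isCompact_uIcc.prod isCompact_uIcc)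
    (hf.comp continuous_swap).continuousOn

/-- The filter of space-time points with time in `[0, t]` and `|x| → ∞`. -/
def farField (t : ℝ) : Filter (ℝ × ℝ) :=
  Filter.principal (Set.Icc 0 t) ×ˢ Filter.comap (fun x : ℝ => |x|) Filter.atTop

lemma tendsto_farField_iff {f : ℝ → ℝ → ℝ} {t : ℝ} :
    Tendsto (fun p : ℝ × ℝ => f p.1 p.2) (farField t) (nhds 0) ↔
      ∀ δ > (0 : ℝ), ∃ M : ℝ, ∀ x : ℝ, M ≤ |x| → ∀ s ∈ Set.Icc (0 : ℝ) t, |f s x| ≤ δ := by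
  have hb := (Filter.hasBasis_principal (Set.Icc (0 : ℝ) t)).prod
    ((Filter.atTop_basis (α := ℝ)).comap (fun x : ℝ => |x|))
  rw [farField, hb.tendsto_iff Metric.nhds_basis_closedBall]
  refine forall₂_congr fun δ _ => ⟨?_, ?_⟩
  · rintro ⟨⟨_, M⟩, -, h⟩
    exact ⟨M, fun x hx s hs => by simpa using h (s, x) ⟨hs, hx⟩⟩
  · rintro ⟨M, h⟩
    exact ⟨⟨(), M⟩, ⟨trivial, trivial⟩, fun p hp => by simpa using h p.2 hp.2 p.1 hp.1⟩

/-- The density `e` and the dissipation `d` satisfy a balance law `∂ₜ e + ∂ₓ q + d = 0` on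
`(0, t) × ℝ` with a flux `q` vanishing at infinity uniformly in time. -/
def LocalBalance (t : ℝ) (e d : ℝ → ℝ → ℝ) : Prop :=
  Continuous (fun p : ℝ × ℝ => e p.1 p.2) ∧
  ∃ e' q q' : ℝ → ℝ → ℝ,
    (∀ s x, HasDerivAt (fun r => e r x) (e' s x) s) ∧
    (∀ s x, HasDerivAt (fun y => q s y) (q' s x) x) ∧
    Continuous (fun p : ℝ × ℝ => e' p.1 p.2) ∧
    Continuous (fun p : ℝ × ℝ => q' p.1 p.2) ∧
    Tendsto (fun p : ℝ × ℝ => q p.1 p.2) (farField t) (nhds 0) ∧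
    ∀ s ∈ Set.Ioo 0 t, ∀ x, e' s x + q' s x + d s x = 0

lemma LocalBalance.add {t : ℝ} {e₁ d₁ e₂ d₂ : ℝ → ℝ → ℝ} (h₁ : LocalBalance t e₁ d₁)
    (h₂ : LocalBalance t e₂ d₂) :
    LocalBalance t (fun s x => e₁ s x + e₂ s x) (fun s x => d₁ s x + d₂ s x) := by
  obtain ⟨hec, e', q, q', he, hq, he'c, hq'c, hq0, hbal⟩ := h₁
  obtain ⟨hec₂, e'₂, q₂, q'₂, he₂, hq₂, he'c₂, hq'c₂, hq0₂, hbal₂⟩ := h₂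
  refine ⟨hec.add hec₂, fun s x => e' s x + e'₂ s x, fun s x => q s x + q₂ s x,
    fun s x => q' s x + q'₂ s x, fun s x => (he s x).add (he₂ s x),
    fun s x => (hq s x).add (hq₂ s x), he'c.add he'c₂, hq'c.add hq'c₂, ?_, fun s hs x => ?_⟩
  · simpa using hq0.add hq0₂
  · linarith [hbal s hs x, hbal₂ s hs x]

lemma LocalBalance.const_mul {t : ℝ} {e d : ℝ → ℝ → ℝ} (h : LocalBalance t e d) (c : ℝ) :
    LocalBalance t (fun s x => c * e s x) (fun s x => c * d s x) := by
  obtain ⟨hec, e', q, q', he, hq, he'c, hq'c, hq0, hbal⟩ := h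
  refine ⟨hec.const_mul c, fun s x => c * e' s x, fun s x => c * q s x,
    fun s x => c * q' s x, fun s x => (he s x).const_mul c, fun s x => (hq s x).const_mul c,
    he'c.const_mul c, hq'c.const_mul c, ?_, fun s hs x => ?_⟩
  · simpa using hq0.const_mul c
  · linear_combination c * hbal s hs x

/-- Integrated form of a local balance law with nonnegative density `e`, when the dissipation
is bounded below by a nonnegative continuous function `d`. -/
lemma LocalBalance.integral_le {e d₀ d : ℝ → ℝ → ℝ} {t A : ℝ} (h : LocalBalance t e d₀)
    (ht : 0 < t) (hdc : Continuous (fun p : ℝ × ℝ => d p.1 p.2))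
    (hdd : ∀ s ∈ Set.Ioo 0 t, ∀ x, d s x ≤ d₀ s x)
    (he0 : ∀ s x, 0 ≤ e s x) (hd0 : ∀ s x, 0 ≤ d s x)
    (hA : ∀ R ≥ (0 : ℝ), ∫ x in (-R)..R, e 0 x ≤ A) (R : ℝ) (hR : 0 ≤ R) :
    (∫ x in (-R)..R, e t x) + ∫ s in (0 : ℝ)..t, ∫ x in (-R)..R, d s x ≤ A := by
  obtain ⟨hec, e', q, q', he, hq, he'c, hq'c, hq0, hbal₀⟩ := h
  have hbal : ∀ s ∈ Set.Ioo 0 t, ∀ x, e' s x + q' s x + d s x ≤ 0 := fun s hs x => by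
    linarith [hbal₀ s hs x, hdd s hs x]
  have hi := fun {f : ℝ → ℝ → ℝ} (hf : Continuous (fun p : ℝ × ℝ => f p.1 p.2)) =>
    intervalIntegrable_of_continuous_uncurry hf
  refine le_of_forall_pos_le_add fun η hη => ?_
  obtain ⟨M, hM⟩ := tendsto_farField_iff.1 hq0 (η / (2 * t)) (by positivity)
  set S := max R M with hS
  have hRS : R ≤ S := le_max_left _ _
  have hS0 : 0 ≤ S := hR.trans hRS
  have hmono : ∀ {f : ℝ → ℝ → ℝ}, Continuous (fun p : ℝ × ℝ => f p.1 p.2) →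
      (∀ s x, 0 ≤ f s x) → ∀ s, ∫ x in (-R)..R, f s x ≤ ∫ x in (-S)..S, f s x := by
    intro f hf h0 s
    exact intervalIntegral.integral_mono_interval (by linarith) (by linarith) hRS
      (Filter.Eventually.of_forall fun x => h0 s x) (hi hf s _ _)
  have h1 : (∫ s in (0 : ℝ)..t, ∫ x in (-R)..R, d s x) ≤
      ∫ s in (0 : ℝ)..t, ∫ x in (-S)..S, d s x :=
    intervalIntegral.integral_mono_on ht.le
      ((continuous_intervalIntegral_snd hdc _ _).intervalIntegrable _ _)
      ((continuous_intervalIntegral_snd hdc _ _).intervalIntegrable _ _)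
      (fun s _ => hmono hdc hd0 s)
  have h2 : (∫ x in (-S)..S, e t x) - ∫ x in (-S)..S, e 0 x =
      ∫ s in (0 : ℝ)..t, ∫ x in (-S)..S, e' s x := by
    rw [← intervalIntegral.integral_sub (hi hec _ _ _) (hi hec _ _ _),
      ← intervalIntegral_swap_of_continuous he'c]
    refine intervalIntegral.integral_congr fun x _ => ?_
    exact (intervalIntegral.integral_eq_sub_of_hasDerivAt (fun s _ => he s x)
      ((he'c.comp (Continuous.prodMk_left x)).intervalIntegrable _ _)).symm
  have h3 : (∫ s in (0 : ℝ)..t, ∫ x in (-S)..S, e' s x) +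
      (∫ s in (0 : ℝ)..t, ∫ x in (-S)..S, d s x) ≤ ∫ _s in (0 : ℝ)..t, η / t := by
    rw [← intervalIntegral.integral_add
      ((continuous_intervalIntegral_snd he'c _ _).intervalIntegrable _ _)
      ((continuous_intervalIntegral_snd hdc _ _).intervalIntegrable _ _)]
    refine intervalIntegral.integral_mono_on_of_le_Ioo ht.le
      (((continuous_intervalIntegral_snd he'c _ _).add
        (continuous_intervalIntegral_snd hdc _ _)).intervalIntegrable _ _)
      (by simp) fun s hs => ?_
    rw [← intervalIntegral.integral_add (hi he'c _ _ _) (hi hdc _ _ _)]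
    have h4 : ∫ x in (-S)..S, (e' s x + d s x) ≤ ∫ x in (-S)..S, -q' s x :=
      intervalIntegral.integral_mono_on (by linarith)
        ((hi he'c _ _ _).add (hi hdc _ _ _)) (hi hq'c _ _ _).neg
        fun x _ => by linarith [hbal s hs x]
    have h5 : ∫ x in (-S)..S, q' s x = q s S - q s (-S) :=
      intervalIntegral.integral_eq_sub_of_hasDerivAt (fun x _ => hq s x) (hi hq'c _ _ _)
    rw [intervalIntegral.integral_neg, h5] at h4
    have hs' : s ∈ Set.Icc 0 t := Set.Ioo_subset_Icc_self hs
    have hMS : M ≤ |S| := (le_max_right R M).trans (le_abs_self S)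
    have h6 := abs_le.1 (hM S hMS s hs')
    have h7 := abs_le.1 (hM (-S) (by rwa [abs_neg]) s hs')
    have h8 : η / t = η / (2 * t) + η / (2 * t) := by field_simp; ring
    rw [h8]
    linarith [h6.1, h7.2]
  have h9 : ∫ _s in (0 : ℝ)..t, η / t = η := by
    rw [intervalIntegral.integral_const, smul_eq_mul]; field_simp; ring
  linarith [hmono hec he0 t, hA S hS0]

/-- A nonnegative double integral over `[0, t] × ℝ` is bounded as soon as its truncations are. -/
lemma integral_integral_le_of_truncations {g : ℝ → ℝ → ℝ} {t B : ℝ} (ht : 0 ≤ t) (hB : 0 ≤ B)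
    (hgc : Continuous (fun p : ℝ × ℝ => g p.1 p.2)) (hg0 : ∀ s x, 0 ≤ g s x)
    (hgi : ∀ s ∈ Set.Icc 0 t, Integrable (g s))
    (h : ∀ R ≥ (0 : ℝ), ∫ s in (0 : ℝ)..t, ∫ x in (-R)..R, g s x ≤ B) :
    ∫ s in (0 : ℝ)..t, ∫ x, g s x ≤ B := by
  by_cases hint : IntervalIntegrable (fun s => ∫ x, g s x) volume 0 t
  swap
  · rwa [intervalIntegral.integral_undef hint]
  rw [intervalIntegrable_iff_integrableOn_Ioc_of_le ht] at hint
  rw [intervalIntegral.integral_of_le ht]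
  have hlim : Tendsto (fun n : ℕ => ∫ s in Set.Ioc 0 t, ∫ x in (-(n : ℝ))..n, g s x) atTop
      (nhds (∫ s in Set.Ioc 0 t, ∫ x, g s x)) := by
    refine integral_tendsto_of_tendsto_of_monotone (fun n => ?_) hint ?_ ?_
    · exact (continuous_intervalIntegral_snd hgc _ _).integrableOn_Ioc
    · refine Filter.Eventually.of_forall fun s m n hmn => ?_
      have hmn' : (m : ℝ) ≤ n := by exact_mod_cast hmn
      have hm : (0 : ℝ) ≤ m := m.cast_nonneg
      exact intervalIntegral.integral_mono_interval (by linarith) (by linarith) hmn'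
        (Filter.Eventually.of_forall fun x => hg0 s x)
        (intervalIntegrable_of_continuous_uncurry hgc s _ _)
    · refine (ae_restrict_iff' measurableSet_Ioc).2 (Filter.Eventually.of_forall fun s hs => ?_)
      exact intervalIntegral_tendsto_integral (hgi s (Set.Ioc_subset_Icc_self hs))
        (tendsto_neg_atTop_atBot.comp tendsto_natCast_atTop_atTop) tendsto_natCast_atTop_atTop
  refine le_of_tendsto' hlim fun n => ?_
  have := h n n.cast_nonneg
  rwa [intervalIntegral.integral_of_le ht] at this

lemma intervalIntegral_le_integral {f : ℝ → ℝ} (hf : Integrable f) (h0 : ∀ x, 0 ≤ f x) {R : ℝ}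
    (hR : 0 ≤ R) : ∫ x in (-R)..R, f x ≤ ∫ x, f x := by
  rw [intervalIntegral.integral_of_le (by linarith)]
  exact setIntegral_le_integral hf (Filter.Eventually.of_forall h0)

/-! ### Balance laws for the Rosenau–KdV–RLW approximation -/

section Admissible

variable {ε β : ℝ} {u : ℝ → ℝ → ℝ}

lemma IsAdmissibleKdVRLW.equation (h : IsAdmissibleKdVRLW ε β u) {t : ℝ} (ht : 0 < t) (x : ℝ) :
    mixedD u 1 0 t x + 2 * mixedD u 0 0 t x * mixedD u 0 1 t x + β * mixedD u 0 3 t x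
      - β * mixedD u 1 2 t x + β ^ 2 * mixedD u 1 4 t x = ε * mixedD u 0 2 t x := by
  have h00 : ∀ y, mixedD u 0 0 t y = u t y := fun y => by simp [mixedD]
  have hd : deriv (fun y => u t y ^ 2) x = 2 * mixedD u 0 0 t x * mixedD u 0 1 t x := by
    have := (hasDerivAt_mixedD_space h.smooth 0 0 t x).fun_pow 2
    simp only [h00] at this ⊢
    simpa using this.deriv
  rw [← hd]
  exact h.pde t ht x

lemma IsAdmissibleKdVRLW.tendsto_farField (h : IsAdmissibleKdVRLW ε β u) {t : ℝ} (ht : 0 < t)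
    (j k : ℕ) (hjk : j + k ≤ 5) :
    Tendsto (fun p : ℝ × ℝ => mixedD u j k p.1 p.2) (farField t) (nhds 0) :=
  tendsto_farField_iff.2 (h.decay t ht j k hjk)

lemma IsAdmissibleKdVRLW.localBalance_energy (h : IsAdmissibleKdVRLW ε β u)
    {t : ℝ} (ht : 0 < t) :
    LocalBalance t
      (fun s x => mixedD u 0 0 s x ^ 2 + β * mixedD u 0 1 s x ^ 2 + β ^ 2 * mixedD u 0 2 s x ^ 2)
      (fun s x => 2 * ε * mixedD u 0 1 s x ^ 2) := by
  have C := continuous_mixedD h.smooth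
  have T := hasDerivAt_mixedD_time h.smooth
  have X := hasDerivAt_mixedD_space h.smooth
  have Z := h.tendsto_farField ht
  have c00 := C 0 0; have c01 := C 0 1; have c02 := C 0 2; have c03 := C 0 3
  have c10 := C 1 0; have c11 := C 1 1; have c12 := C 1 2; have c14 := C 1 4
  refine ⟨by fun_prop,
    fun s x => 2 * mixedD u 0 0 s x * mixedD u 1 0 s x
      + β * (2 * mixedD u 0 1 s x * mixedD u 1 1 s x)
      + β ^ 2 * (2 * mixedD u 0 2 s x * mixedD u 1 2 s x),
    fun s x => (4 / 3) * mixedD u 0 0 s x ^ 3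
      + β * (2 * (mixedD u 0 0 s x * mixedD u 0 2 s x) - mixedD u 0 1 s x ^ 2)
      - (2 * β) * (mixedD u 0 0 s x * mixedD u 1 1 s x)
      + (2 * β ^ 2) * (mixedD u 0 0 s x * mixedD u 1 3 s x - mixedD u 0 1 s x * mixedD u 1 2 s x)
      - (2 * ε) * (mixedD u 0 0 s x * mixedD u 0 1 s x),
    fun s x => 4 * mixedD u 0 0 s x ^ 2 * mixedD u 0 1 s x
      + 2 * β * mixedD u 0 0 s x * mixedD u 0 3 s x
      - 2 * β * (mixedD u 0 1 s x * mixedD u 1 1 s x + mixedD u 0 0 s x * mixedD u 1 2 s x)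
      + 2 * β ^ 2 * (mixedD u 0 0 s x * mixedD u 1 4 s x - mixedD u 0 2 s x * mixedD u 1 2 s x)
      - 2 * ε * (mixedD u 0 1 s x ^ 2 + mixedD u 0 0 s x * mixedD u 0 2 s x),
    fun s x => ?_, fun s x => ?_, by fun_prop, by fun_prop, ?_, fun s hs x => ?_⟩
  · refine ((((T 0 0 s x).fun_pow 2).fun_add (((T 0 1 s x).fun_pow 2).const_mul β)).fun_add
      (((T 0 2 s x).fun_pow 2).const_mul (β ^ 2))).congr_deriv ?_
    norm_num
  · refine ((((((X 0 0 s x).fun_pow 3).const_mul (4 / 3)).fun_add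
      (((((X 0 0 s x).fun_mul (X 0 2 s x)).const_mul 2).fun_sub
        ((X 0 1 s x).fun_pow 2)).const_mul β)).fun_sub
      (((X 0 0 s x).fun_mul (X 1 1 s x)).const_mul (2 * β))).fun_add
      ((((X 0 0 s x).fun_mul (X 1 3 s x)).fun_sub
        ((X 0 1 s x).fun_mul (X 1 2 s x))).const_mul (2 * β ^ 2))).fun_sub
      (((X 0 0 s x).fun_mul (X 0 1 s x)).const_mul (2 * ε)) |>.congr_deriv ?_
    norm_num
    ring
  · have z00 := Z 0 0 (by norm_num); have z01 := Z 0 1 (by norm_num)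
    have z02 := Z 0 2 (by norm_num); have z11 := Z 1 1 (by norm_num)
    have z12 := Z 1 2 (by norm_num); have z13 := Z 1 3 (by norm_num)
    simpa using (((((z00.pow 3).const_mul (4 / 3)).add
      ((((z00.mul z02).const_mul 2).sub (z01.pow 2)).const_mul β)).sub
      ((z00.mul z11).const_mul (2 * β))).add
      (((z00.mul z13).sub (z01.mul z12)).const_mul (2 * β ^ 2))).sub
      ((z00.mul z01).const_mul (2 * ε))
  · linear_combination 2 * mixedD u 0 0 s x * h.equation hs.1 x

lemma IsAdmissibleKdVRLW.localBalance_gradient (h : IsAdmissibleKdVRLW ε β u)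
    {t : ℝ} (ht : 0 < t) :
    LocalBalance t
      (fun s x => mixedD u 0 1 s x ^ 2 + β * mixedD u 0 2 s x ^ 2 + β ^ 2 * mixedD u 0 3 s x ^ 2)
      (fun s x => 2 * ε * mixedD u 0 2 s x ^ 2
        - 4 * mixedD u 0 0 s x * mixedD u 0 1 s x * mixedD u 0 2 s x) := by
  have C := continuous_mixedD h.smooth
  have T := hasDerivAt_mixedD_time h.smooth
  have X := hasDerivAt_mixedD_space h.smooth
  have Z := h.tendsto_farField ht
  have c01 := C 0 1; have c02 := C 0 2; have c03 := C 0 3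
  have c10 := C 1 0; have c11 := C 1 1; have c12 := C 1 2; have c13 := C 1 3; have c14 := C 1 4
  refine ⟨by fun_prop,
    fun s x => 2 * mixedD u 0 1 s x * mixedD u 1 1 s x
      + β * (2 * mixedD u 0 2 s x * mixedD u 1 2 s x)
      + β ^ 2 * (2 * mixedD u 0 3 s x * mixedD u 1 3 s x),
    fun s x => (-2) * (mixedD u 0 1 s x * mixedD u 1 0 s x) - β * mixedD u 0 2 s x ^ 2
      - (2 * β ^ 2) * (mixedD u 0 2 s x * mixedD u 1 3 s x),
    fun s x => (-2) * (mixedD u 0 2 s x * mixedD u 1 0 s x + mixedD u 0 1 s x * mixedD u 1 1 s x)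
      - β * (2 * mixedD u 0 2 s x * mixedD u 0 3 s x)
      - 2 * β ^ 2 * (mixedD u 0 3 s x * mixedD u 1 3 s x + mixedD u 0 2 s x * mixedD u 1 4 s x),
    fun s x => ?_, fun s x => ?_, by fun_prop, by fun_prop, ?_, fun s hs x => ?_⟩
  · refine ((((T 0 1 s x).fun_pow 2).fun_add (((T 0 2 s x).fun_pow 2).const_mul β)).fun_add
      (((T 0 3 s x).fun_pow 2).const_mul (β ^ 2))).congr_deriv ?_
    norm_num
  · refine (((((X 0 1 s x).fun_mul (X 1 0 s x)).const_mul (-2)).fun_sub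
      (((X 0 2 s x).fun_pow 2).const_mul β)).fun_sub
      (((X 0 2 s x).fun_mul (X 1 3 s x)).const_mul (2 * β ^ 2))).congr_deriv ?_
    norm_num
  · have z01 := Z 0 1 (by norm_num); have z02 := Z 0 2 (by norm_num)
    have z10 := Z 1 0 (by norm_num); have z13 := Z 1 3 (by norm_num)
    simpa using (((z01.mul z10).const_mul (-2)).sub ((z02.pow 2).const_mul β)).sub
      ((z02.mul z13).const_mul (2 * β ^ 2))
  · linear_combination (-2) * mixedD u 0 2 s x * h.equation hs.1 x

lemma IsAdmissibleKdVRLW.localBalance_secondDeriv (h : IsAdmissibleKdVRLW ε β u)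
    {t : ℝ} (ht : 0 < t) :
    LocalBalance t
      (fun s x => ε * mixedD u 0 2 s x ^ 2)
      (fun s x => 2 * mixedD u 1 1 s x ^ 2 + 2 * β * mixedD u 1 2 s x ^ 2
        + 2 * β ^ 2 * mixedD u 1 3 s x ^ 2
        - 4 * mixedD u 0 0 s x * mixedD u 0 1 s x * mixedD u 1 2 s x
        + 2 * β * mixedD u 1 3 s x * mixedD u 0 2 s x) := by
  have C := continuous_mixedD h.smooth
  have T := hasDerivAt_mixedD_time h.smooth
  have X := hasDerivAt_mixedD_space h.smooth
  have Z := h.tendsto_farField ht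
  have c02 := C 0 2; have c03 := C 0 3
  have c10 := C 1 0; have c11 := C 1 1; have c12 := C 1 2; have c13 := C 1 3; have c14 := C 1 4
  refine ⟨by fun_prop,
    fun s x => ε * (2 * mixedD u 0 2 s x * mixedD u 1 2 s x),
    fun s x => (-2) * (mixedD u 1 0 s x * mixedD u 1 1 s x)
      - (2 * β) * (mixedD u 1 2 s x * mixedD u 0 2 s x)
      - (2 * β ^ 2) * (mixedD u 1 2 s x * mixedD u 1 3 s x),
    fun s x => (-2) * (mixedD u 1 1 s x * mixedD u 1 1 s x + mixedD u 1 0 s x * mixedD u 1 2 s x)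
      - 2 * β * (mixedD u 1 3 s x * mixedD u 0 2 s x + mixedD u 1 2 s x * mixedD u 0 3 s x)
      - 2 * β ^ 2 * (mixedD u 1 3 s x * mixedD u 1 3 s x + mixedD u 1 2 s x * mixedD u 1 4 s x),
    fun s x => ?_, fun s x => ?_, by fun_prop, by fun_prop, ?_, fun s hs x => ?_⟩
  · refine (((T 0 2 s x).fun_pow 2).const_mul ε).congr_deriv ?_
    norm_num
  · exact ((((X 1 0 s x).fun_mul (X 1 1 s x)).const_mul (-2)).fun_sub
      (((X 1 2 s x).fun_mul (X 0 2 s x)).const_mul (2 * β))).fun_sub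
      (((X 1 2 s x).fun_mul (X 1 3 s x)).const_mul (2 * β ^ 2))
  · have z02 := Z 0 2 (by norm_num); have z10 := Z 1 0 (by norm_num)
    have z11 := Z 1 1 (by norm_num); have z12 := Z 1 2 (by norm_num)
    have z13 := Z 1 3 (by norm_num)
    simpa using (((z10.mul z11).const_mul (-2)).sub ((z12.mul z02).const_mul (2 * β))).sub
      ((z12.mul z13).const_mul (2 * β ^ 2))
  · linear_combination (-2) * mixedD u 1 2 s x * h.equation hs.1 x

lemma IsAdmissibleKdVRLW.localBalance_fourthPower (h : IsAdmissibleKdVRLW ε β u)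
    {t : ℝ} (ht : 0 < t) :
    LocalBalance t
      (fun s x => mixedD u 0 0 s x ^ 4)
      (fun s x => 12 * ε * mixedD u 0 0 s x ^ 2 * mixedD u 0 1 s x ^ 2
        - 12 * β * mixedD u 0 0 s x ^ 2 * mixedD u 0 1 s x * mixedD u 0 2 s x
        + 12 * β * mixedD u 0 0 s x ^ 2 * mixedD u 0 1 s x * mixedD u 1 1 s x
        - 12 * β ^ 2 * mixedD u 0 0 s x ^ 2 * mixedD u 0 1 s x * mixedD u 1 3 s x) := by
  have C := continuous_mixedD h.smooth
  have T := hasDerivAt_mixedD_time h.smooth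
  have X := hasDerivAt_mixedD_space h.smooth
  have Z := h.tendsto_farField ht
  have c00 := C 0 0; have c01 := C 0 1; have c02 := C 0 2; have c03 := C 0 3
  have c10 := C 1 0; have c11 := C 1 1; have c12 := C 1 2; have c13 := C 1 3; have c14 := C 1 4
  refine ⟨by fun_prop,
    fun s x => 4 * mixedD u 0 0 s x ^ 3 * mixedD u 1 0 s x,
    fun s x => (8 / 5) * mixedD u 0 0 s x ^ 5
      + mixedD u 0 0 s x ^ 3 * ((4 * β) * mixedD u 0 2 s x - (4 * β) * mixedD u 1 1 s x
        + (4 * β ^ 2) * mixedD u 1 3 s x - (4 * ε) * mixedD u 0 1 s x),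
    fun s x => 8 * mixedD u 0 0 s x ^ 4 * mixedD u 0 1 s x
      + (3 * mixedD u 0 0 s x ^ 2 * mixedD u 0 1 s x
          * ((4 * β) * mixedD u 0 2 s x - (4 * β) * mixedD u 1 1 s x
            + (4 * β ^ 2) * mixedD u 1 3 s x - (4 * ε) * mixedD u 0 1 s x)
        + mixedD u 0 0 s x ^ 3 * ((4 * β) * mixedD u 0 3 s x - (4 * β) * mixedD u 1 2 s x
            + (4 * β ^ 2) * mixedD u 1 4 s x - (4 * ε) * mixedD u 0 2 s x)),
    fun s x => ?_, fun s x => ?_, by fun_prop, by fun_prop, ?_, fun s hs x => ?_⟩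
  · refine ((T 0 0 s x).fun_pow 4).congr_deriv ?_
    norm_num
  · refine ((((X 0 0 s x).fun_pow 5).const_mul (8 / 5)).fun_add
      (((X 0 0 s x).fun_pow 3).fun_mul (((((X 0 2 s x).const_mul (4 * β)).fun_sub
        ((X 1 1 s x).const_mul (4 * β))).fun_add ((X 1 3 s x).const_mul (4 * β ^ 2))).fun_sub
        ((X 0 1 s x).const_mul (4 * ε))))).congr_deriv ?_
    norm_num
    ring
  · have z00 := Z 0 0 (by norm_num); have z01 := Z 0 1 (by norm_num)
    have z02 := Z 0 2 (by norm_num); have z11 := Z 1 1 (by norm_num)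
    have z13 := Z 1 3 (by norm_num)
    simpa using ((z00.pow 5).const_mul (8 / 5)).add ((z00.pow 3).mul
      ((((z02.const_mul (4 * β)).sub (z11.const_mul (4 * β))).add
      (z13.const_mul (4 * β ^ 2))).sub (z01.const_mul (4 * ε))))
  · linear_combination 4 * mixedD u 0 0 s x ^ 3 * h.equation hs.1 x

end Admissible

/-! ### A priori bounds -/

lemma mul_le_of_sq_le {ε a c p w : ℝ} (hε : 0 < ε) (hca : 36 * c ^ 2 ≤ ε * a) :
    |12 * c * p * w| ≤ ε * p ^ 2 + a * w ^ 2 := by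
  have hw : 36 * c ^ 2 * w ^ 2 ≤ ε * a * w ^ 2 := mul_le_mul_of_nonneg_right hca (sq_nonneg w)
  rw [abs_le]
  constructor
  · refine le_of_mul_le_mul_left ?_ hε
    nlinarith [sq_nonneg (ε * p + 6 * c * w)]
  · refine le_of_mul_le_mul_left ?_ hε
    nlinarith [sq_nonneg (ε * p - 6 * c * w)]

/-- Coercivity of the combined dissipation when the dispersion `b ^ 2` is small. -/
lemma dissipation_lower_bound {ε b D K U p w v y z : ℝ} (hε : 0 < ε) (hb : 0 < b) (hb1 : b ≤ 1)
    (hbD : b ≤ D * ε ^ 2) (hD2 : D ≤ 1 / 2) (hK : 0 ≤ K) (hKD : 36 * K * D ≤ 1 / 4)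
    (hU : b * U ^ 2 ≤ K) :
    ε ^ 3 / 4 * w ^ 2 ≤ 12 * ε * p ^ 2 - 12 * b ^ 2 * U * p * w + 12 * b ^ 2 * U * p * v
      - 12 * b ^ 4 * U * p * z + ε ^ 2 / 2 * (2 * ε * w ^ 2 - 4 * p * w)
      + b ^ 2 * ε / 2 * (2 * v ^ 2 + 2 * b ^ 2 * y ^ 2 + 2 * b ^ 4 * z ^ 2 - 4 * p * y
        + 2 * b ^ 2 * z * w) := by
  have hbε : b ≤ ε ^ 2 / 2 := hbD.trans (by nlinarith [sq_nonneg ε])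
  have hb2ε : b ^ 2 ≤ ε ^ 2 / 2 := by nlinarith
  have hKb : 36 * (b ^ 2 * U) ^ 2 ≤ ε ^ 2 / 4 * b ^ 2 := by
    have h1 : b ^ 3 * (b * U ^ 2) ≤ b ^ 3 * K := mul_le_mul_of_nonneg_left hU (by positivity)
    have h2 : b ^ 2 * K * b ≤ b ^ 2 * K * (D * ε ^ 2) :=
      mul_le_mul_of_nonneg_left hbD (by positivity)
    have h3 : 36 * K * D * (b ^ 2 * ε ^ 2) ≤ 1 / 4 * (b ^ 2 * ε ^ 2) :=
      mul_le_mul_of_nonneg_right hKD (by positivity)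
    nlinarith
  have hw : |12 * (b ^ 2 * U) * p * w| ≤ ε * p ^ 2 + ε ^ 3 / 8 * w ^ 2 :=
    mul_le_of_sq_le hε (by nlinarith [sq_nonneg ε])
  have hv : |12 * (b ^ 2 * U) * p * v| ≤ ε * p ^ 2 + ε * b ^ 2 / 4 * v ^ 2 :=
    mul_le_of_sq_le hε (by linarith)
  have hz : |12 * (b ^ 4 * U) * p * z| ≤ ε * p ^ 2 + ε * b ^ 6 / 4 * z ^ 2 :=
    mul_le_of_sq_le hε (by
      have := mul_le_mul_of_nonneg_left hKb (by positivity : 0 ≤ b ^ 4)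
      linarith)
  have hpw : 2 * ε ^ 2 * p * w ≤ 4 * ε * p ^ 2 + ε ^ 3 / 4 * w ^ 2 := by
    nlinarith [mul_nonneg hε.le (sq_nonneg (2 * p - ε / 2 * w))]
  have hpy : 2 * ε * b ^ 2 * p * y ≤ ε * p ^ 2 + ε * b ^ 4 * y ^ 2 := by
    nlinarith [mul_nonneg hε.le (sq_nonneg (p - b ^ 2 * y))]
  have hzw : -(ε * b ^ 4 * z * w) ≤ ε * b ^ 6 / 2 * z ^ 2 + ε ^ 3 / 4 * w ^ 2 := by
    have h1 : ε * w ^ 2 * b ^ 2 ≤ ε * w ^ 2 * (ε ^ 2 / 2) :=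
      mul_le_mul_of_nonneg_left hb2ε (by positivity)
    nlinarith [mul_nonneg hε.le (sq_nonneg (b ^ 3 * z + b * w))]
  have n1 : 0 ≤ ε * p ^ 2 := by positivity
  have n2 : 0 ≤ ε ^ 3 * w ^ 2 := by positivity
  have n3 : 0 ≤ ε * b ^ 2 * v ^ 2 := by positivity
  have n4 : 0 ≤ ε * b ^ 6 * z ^ 2 := by positivity
  linarith [(abs_le.1 hw).2, (abs_le.1 hv).1, (abs_le.1 hz).2]

section Bounds

variable {ε β : ℝ} {u : ℝ → ℝ → ℝ}

lemma IsAdmissibleKdVRLW.integrable_sq (h : IsAdmissibleKdVRLW ε β u) {t : ℝ} (ht : 0 ≤ t) (k : ℕ)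
    (hk : k ≤ 5) : Integrable (fun x => mixedD u 0 k t x ^ 2) :=
  h.sq_int (t + 1) (by linarith) 0 k (by omega) t ⟨ht, by linarith⟩

lemma IsAdmissibleKdVRLW.integrable_fourthPower_initial (h : IsAdmissibleKdVRLW ε β u) :
    Integrable (fun x => mixedD u 0 0 0 x ^ 4) := by
  have hc : Continuous (fun x => mixedD u 0 0 0 x) :=
    (continuous_mixedD h.smooth 0 0).comp (Continuous.prodMk_right (0 : ℝ))
  obtain ⟨M, hM⟩ := h.decay 1 one_pos 0 0 (by norm_num) 1 one_pos
  obtain ⟨B, hB⟩ := (isCompact_Icc (a := -M) (b := M)).exists_bound_of_continuousOn hc.continuousOn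
  have hbd : ∀ x, |mixedD u 0 0 0 x| ≤ max B 1 := by
    intro x
    rcases le_total M |x| with hx | hx
    · exact (hM x hx 0 (by simp)).trans (le_max_right _ _)
    · exact (hB x (abs_le.1 hx)).trans (le_max_left _ _)
  refine ((h.integrable_sq le_rfl 0 (by norm_num)).const_mul (max B 1 ^ 2)).mono'
    (hc.pow 4).aestronglyMeasurable (Filter.Eventually.of_forall fun x => ?_)
  have h2 : mixedD u 0 0 0 x ^ 2 ≤ max B 1 ^ 2 := sq_le_sq' (abs_le.1 (hbd x)).1 (abs_le.1 (hbd x)).2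
  rw [Real.norm_of_nonneg (by positivity)]
  nlinarith [sq_nonneg (mixedD u 0 0 0 x)]

/-- The data bounds in terms of the mixed derivatives at time zero. -/
lemma DataBoundsKdVRLW.initial_bounds {C0 : ℝ} (hd : DataBoundsKdVRLW ε β C0 (u 0)) :
    (∫ x, mixedD u 0 0 0 x ^ 2) + (∫ x, mixedD u 0 0 0 x ^ 4)
      + (β + ε ^ 2) * (∫ x, mixedD u 0 1 0 x ^ 2) ≤ C0 ∧
    (β * ε + β * ε ^ 2 + β ^ 2) * (∫ x, mixedD u 0 2 0 x ^ 2)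
      + (β ^ 2 * ε ^ 2 + β ^ 3) * (∫ x, mixedD u 0 3 0 x ^ 2) ≤ C0 := by
  refine ⟨?_, ?_⟩
  · simpa [mixedD] using hd.1
  · simpa [mixedD] using hd.2.1

lemma IsAdmissibleKdVRLW.energy_initial (h : IsAdmissibleKdVRLW ε β u) (hε : 0 < ε) (hβ : 0 < β)
    {C0 : ℝ} (hd : DataBoundsKdVRLW ε β C0 (u 0)) (R : ℝ) (hR : 0 ≤ R) :
    ∫ x in (-R)..R, (mixedD u 0 0 0 x ^ 2 + β * mixedD u 0 1 0 x ^ 2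
      + β ^ 2 * mixedD u 0 2 0 x ^ 2) ≤ 2 * C0 := by
  have i := fun k hk => h.integrable_sq le_rfl k hk
  have i0 := i 0 (by norm_num)
  have i1 := (i 1 (by norm_num)).const_mul β
  have i2 := (i 2 (by norm_num)).const_mul (β ^ 2)
  have i01 : Integrable (fun x => mixedD u 0 0 0 x ^ 2 + β * mixedD u 0 1 0 x ^ 2) := i0.add i1
  refine (intervalIntegral_le_integral (i01.add i2) (fun x => by
    simp only [Pi.add_apply]; positivity) hR).trans ?_
  simp only [Pi.add_apply]
  rw [integral_add i01 i2, integral_add i0 i1, integral_const_mul, integral_const_mul]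
  obtain ⟨d1, d2⟩ := hd.initial_bounds
  have n : ∀ k, 0 ≤ ∫ x, mixedD u 0 k 0 x ^ 2 := fun k => integral_nonneg fun x => sq_nonneg _
  have n4 : 0 ≤ ∫ x, mixedD u 0 0 0 x ^ 4 := integral_nonneg fun x => by positivity
  have p1 := mul_nonneg (sq_nonneg ε) (n 1)
  have p2 := mul_nonneg (by positivity : 0 ≤ β * ε + β * ε ^ 2) (n 2)
  have p3 := mul_nonneg (by positivity : 0 ≤ β ^ 2 * ε ^ 2 + β ^ 3) (n 3)
  linarith

lemma IsAdmissibleKdVRLW.gradient_initial (h : IsAdmissibleKdVRLW ε β u) (hε : 0 < ε) (hβ : 0 < β)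
    {C0 : ℝ} (hd : DataBoundsKdVRLW ε β C0 (u 0)) (R : ℝ) (hR : 0 ≤ R) :
    ∫ x in (-R)..R, ε ^ 2 * (mixedD u 0 1 0 x ^ 2 + β * mixedD u 0 2 0 x ^ 2
      + β ^ 2 * mixedD u 0 3 0 x ^ 2) ≤ 2 * C0 := by
  have i := fun k hk => h.integrable_sq le_rfl k hk
  have i1 := i 1 (by norm_num)
  have i2 := (i 2 (by norm_num)).const_mul β
  have i3 := (i 3 (by norm_num)).const_mul (β ^ 2)
  have i12 : Integrable (fun x => mixedD u 0 1 0 x ^ 2 + β * mixedD u 0 2 0 x ^ 2) := i1.add i2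
  refine (intervalIntegral_le_integral ((i12.add i3).const_mul (ε ^ 2)) (fun x => by
    simp only [Pi.add_apply]; positivity) hR).trans ?_
  simp only [Pi.add_apply]
  rw [integral_const_mul, integral_add i12 i3, integral_add i1 i2, integral_const_mul,
    integral_const_mul]
  obtain ⟨d1, d2⟩ := hd.initial_bounds
  have n : ∀ k, 0 ≤ ∫ x, mixedD u 0 k 0 x ^ 2 := fun k => integral_nonneg fun x => sq_nonneg _
  have n4 : 0 ≤ ∫ x, mixedD u 0 0 0 x ^ 4 := integral_nonneg fun x => by positivity
  have p1 := mul_nonneg hβ.le (n 1)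
  have p2 := mul_nonneg (by positivity : 0 ≤ β * ε + β ^ 2) (n 2)
  have p3 := mul_nonneg (by positivity : 0 ≤ β ^ 3) (n 3)
  linarith [n 0]

lemma IsAdmissibleKdVRLW.secondDeriv_initial (h : IsAdmissibleKdVRLW ε β u) (hε : 0 < ε)
    (hβ : 0 < β) {C0 : ℝ} (hd : DataBoundsKdVRLW ε β C0 (u 0)) (R : ℝ) (hR : 0 ≤ R) :
    ∫ x in (-R)..R, β * ε ^ 2 * mixedD u 0 2 0 x ^ 2 ≤ C0 := by
  refine (intervalIntegral_le_integral ((h.integrable_sq le_rfl 2 (by norm_num)).const_mul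
    (β * ε ^ 2)) (fun x => by positivity) hR).trans ?_
  rw [integral_const_mul]
  obtain ⟨d1, d2⟩ := hd.initial_bounds
  have n : ∀ k, 0 ≤ ∫ x, mixedD u 0 k 0 x ^ 2 := fun k => integral_nonneg fun x => sq_nonneg _
  have p2 := mul_nonneg (by positivity : 0 ≤ β * ε + β ^ 2) (n 2)
  have p3 := mul_nonneg (by positivity : 0 ≤ β ^ 2 * ε ^ 2 + β ^ 3) (n 3)
  linarith

lemma IsAdmissibleKdVRLW.fourthPower_initial (h : IsAdmissibleKdVRLW ε β u) (hβ : 0 < β)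
    {C0 : ℝ} (hd : DataBoundsKdVRLW ε β C0 (u 0)) (R : ℝ) (hR : 0 ≤ R) :
    ∫ x in (-R)..R, mixedD u 0 0 0 x ^ 4 ≤ C0 := by
  refine (intervalIntegral_le_integral h.integrable_fourthPower_initial
    (fun x => by positivity) hR).trans ?_
  obtain ⟨d1, d2⟩ := hd.initial_bounds
  have n : ∀ k, 0 ≤ ∫ x, mixedD u 0 k 0 x ^ 2 := fun k => integral_nonneg fun x => sq_nonneg _
  have p1 := mul_nonneg (by positivity : 0 ≤ β + ε ^ 2) (n 1)
  linarith [n 0]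

lemma IsAdmissibleKdVRLW.energy_bound (h : IsAdmissibleKdVRLW ε β u) (hε : 0 < ε) (hβ : 0 < β)
    {C0 : ℝ} (hd : DataBoundsKdVRLW ε β C0 (u 0)) {t : ℝ} (ht : 0 < t) (R : ℝ) (hR : 0 ≤ R) :
    (∫ x in (-R)..R, (mixedD u 0 0 t x ^ 2 + β * mixedD u 0 1 t x ^ 2
        + β ^ 2 * mixedD u 0 2 t x ^ 2))
      + ∫ s in (0 : ℝ)..t, ∫ x in (-R)..R, 2 * ε * mixedD u 0 1 s x ^ 2 ≤ 2 * C0 := by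
  have c01 := continuous_mixedD h.smooth 0 1
  exact (h.localBalance_energy ht).integral_le ht (by fun_prop) (fun s _ x => le_rfl)
    (fun s x => by positivity) (fun s x => by positivity) (h.energy_initial hε hβ hd) R hR

lemma IsAdmissibleKdVRLW.sup_bound {b : ℝ} (h : IsAdmissibleKdVRLW ε (b ^ 2) u) (hε : 0 < ε)
    (hb : 0 < b) {C0 : ℝ} (hd : DataBoundsKdVRLW ε (b ^ 2) C0 (u 0)) {t : ℝ} (ht : 0 < t)
    (x : ℝ) : b * mixedD u 0 0 t x ^ 2 ≤ 2 * C0 := by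
  have c : ∀ k, Continuous (fun y => mixedD u 0 k t y) := fun k =>
    (continuous_mixedD h.smooth 0 k).comp (Continuous.prodMk_right t)
  have c0 := c 0; have c1 := c 1; have c2 := c 2
  refine le_of_forall_pos_le_add fun δ hδ => ?_
  obtain ⟨M, hM⟩ := (tendsto_farField_iff (f := fun s y => mixedD u 0 0 s y ^ 2)).1
    (by simpa using (h.tendsto_farField ht 0 0 (by norm_num)).pow 2) (δ / b) (by positivity)
  set R := max |x| M with hRdef
  have hxR : |x| ≤ R := le_max_left _ _
  have hR : 0 ≤ R := (abs_nonneg x).trans hxR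
  have hR1 : -R ≤ x := (abs_le.1 hxR).1
  have hR2 : x ≤ R := (abs_le.1 hxR).2
  have hbdry : mixedD u 0 0 t (-R) ^ 2 ≤ δ / b :=
    (le_abs_self _).trans (hM (-R) (by rw [abs_neg, abs_of_nonneg hR]; exact le_max_right _ _) t
      ⟨ht.le, le_rfl⟩)
  have hftc : ∫ y in (-R)..x, 2 * mixedD u 0 0 t y * mixedD u 0 1 t y =
      mixedD u 0 0 t x ^ 2 - mixedD u 0 0 t (-R) ^ 2 := by
    refine intervalIntegral.integral_eq_sub_of_hasDerivAt
      (f := fun y => mixedD u 0 0 t y ^ 2) (fun y _ => ?_)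
      (Continuous.intervalIntegrable (by fun_prop) _ _)
    simpa using (hasDerivAt_mixedD_space h.smooth 0 0 t y).fun_pow 2
  have hE : Continuous (fun y => mixedD u 0 0 t y ^ 2 + b ^ 2 * mixedD u 0 1 t y ^ 2
      + (b ^ 2) ^ 2 * mixedD u 0 2 t y ^ 2) := by fun_prop
  have h1 : b * ∫ y in (-R)..x, 2 * mixedD u 0 0 t y * mixedD u 0 1 t y ≤
      ∫ y in (-R)..x, (mixedD u 0 0 t y ^ 2 + b ^ 2 * mixedD u 0 1 t y ^ 2
        + (b ^ 2) ^ 2 * mixedD u 0 2 t y ^ 2) := by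
    rw [← intervalIntegral.integral_const_mul]
    refine intervalIntegral.integral_mono_on hR1
      (Continuous.intervalIntegrable (by fun_prop) _ _) (hE.intervalIntegrable _ _) fun y _ => ?_
    nlinarith [sq_nonneg (mixedD u 0 0 t y - b * mixedD u 0 1 t y),
      sq_nonneg (b ^ 2 * mixedD u 0 2 t y)]
  have h2 := intervalIntegral.integral_mono_interval (μ := volume) le_rfl hR1 hR2
    (Filter.Eventually.of_forall fun y => by simp only [Pi.zero_apply]; positivity)
    (hE.intervalIntegrable (-R) R)
  have h3 : 0 ≤ ∫ s in (0 : ℝ)..t, ∫ y in (-R)..R, 2 * ε * mixedD u 0 1 s y ^ 2 :=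
    intervalIntegral.integral_nonneg ht.le fun s _ =>
      intervalIntegral.integral_nonneg (by linarith) fun y _ => by positivity
  have h4 : b * mixedD u 0 0 t (-R) ^ 2 ≤ δ := by
    rwa [le_div_iff₀ hb, mul_comm] at hbdry
  rw [hftc] at h1
  linarith [h.energy_bound hε (by positivity) hd ht R hR]

/-- Bound on the second derivative in the small dispersion regime. -/
lemma IsAdmissibleKdVRLW.secondDeriv_bound_of_le_one {b D C0 : ℝ}
    (h : IsAdmissibleKdVRLW ε (b ^ 2) u) (hε : 0 < ε) (hb : 0 < b) (hb1 : b ≤ 1)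
    (hbD : b ≤ D * ε ^ 2) (hD2 : D ≤ 1 / 2) (hC0 : 0 ≤ C0) (hCD : 72 * C0 * D ≤ 1 / 4)
    (hd : DataBoundsKdVRLW ε (b ^ 2) C0 (u 0)) {t : ℝ} (ht : 0 < t) (R : ℝ) (hR : 0 ≤ R) :
    ∫ s in (0 : ℝ)..t, ∫ x in (-R)..R, ε ^ 3 / 4 * mixedD u 0 2 s x ^ 2 ≤ 3 * C0 := by
  have hβ : 0 < b ^ 2 := by positivity
  have c00 := continuous_mixedD h.smooth 0 0
  have c01 := continuous_mixedD h.smooth 0 1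
  have c02 := continuous_mixedD h.smooth 0 2
  have c03 := continuous_mixedD h.smooth 0 3
  have key := (((h.localBalance_fourthPower ht).add
    ((h.localBalance_gradient ht).const_mul (ε ^ 2 / 2))).add
    ((h.localBalance_secondDeriv ht).const_mul (b ^ 2 * ε / 2))).integral_le (A := 3 * C0) ht
    (d := fun s x => ε ^ 3 / 4 * mixedD u 0 2 s x ^ 2) (by fun_prop) (fun s hs x => ?_)
    (fun s x => by positivity) (fun s x => by positivity) (fun R hR => ?_) R hR
  · refine (le_add_of_nonneg_left ?_).trans key
    exact intervalIntegral.integral_nonneg (by linarith) fun y _ => by positivity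
  · have := dissipation_lower_bound (p := mixedD u 0 0 s x * mixedD u 0 1 s x)
      (w := mixedD u 0 2 s x) (v := mixedD u 1 1 s x) (y := mixedD u 1 2 s x)
      (z := mixedD u 1 3 s x) hε hb hb1 hbD hD2 (by positivity : 0 ≤ 2 * C0) (by linarith)
      (h.sup_bound hε hb hd hs.1 x)
    refine this.trans (le_of_eq ?_)
    ring
  · have i := fun {f : ℝ → ℝ → ℝ} (hf : Continuous (fun p : ℝ × ℝ => f p.1 p.2)) =>
      intervalIntegrable_of_continuous_uncurry hf 0 (-R) R
    rw [intervalIntegral.integral_add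
        (i (f := fun s x => mixedD u 0 0 s x ^ 4 + ε ^ 2 / 2 * (mixedD u 0 1 s x ^ 2
          + b ^ 2 * mixedD u 0 2 s x ^ 2 + (b ^ 2) ^ 2 * mixedD u 0 3 s x ^ 2)) (by fun_prop))
        (i (f := fun s x => b ^ 2 * ε / 2 * (ε * mixedD u 0 2 s x ^ 2)) (by fun_prop)),
      intervalIntegral.integral_add (i (f := fun s x => mixedD u 0 0 s x ^ 4) (by fun_prop))
        (i (f := fun s x => ε ^ 2 / 2 * (mixedD u 0 1 s x ^ 2
          + b ^ 2 * mixedD u 0 2 s x ^ 2 + (b ^ 2) ^ 2 * mixedD u 0 3 s x ^ 2)) (by fun_prop))]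
    have h1 := h.fourthPower_initial hβ hd R hR
    have h2 := h.gradient_initial hε hβ hd R hR
    have h3 := h.secondDeriv_initial hε hβ hd R hR
    simp only [intervalIntegral.integral_const_mul] at h2 h3 ⊢
    linarith

/-- Bound on the second derivative in the large dispersion regime. -/
lemma IsAdmissibleKdVRLW.secondDeriv_bound_of_one_le {b C0 : ℝ}
    (h : IsAdmissibleKdVRLW ε (b ^ 2) u) (hε : 0 < ε) (hb1 : 1 ≤ b) (hC0 : 0 ≤ C0)
    (hd : DataBoundsKdVRLW ε (b ^ 2) C0 (u 0)) {t : ℝ} (ht : 0 < t) (R : ℝ) (hR : 0 ≤ R) :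
    ∫ s in (0 : ℝ)..t, ∫ x in (-R)..R, ε ^ 3 * mixedD u 0 2 s x ^ 2 ≤ 2 * C0 + 8 * C0 ^ 2 := by
  have hb : 0 < b := by linarith
  have hβ : 0 < b ^ 2 := by positivity
  have c00 := continuous_mixedD h.smooth 0 0
  have c01 := continuous_mixedD h.smooth 0 1
  have c02 := continuous_mixedD h.smooth 0 2
  have c03 := continuous_mixedD h.smooth 0 3
  have key := (((h.localBalance_gradient ht).const_mul (ε ^ 2)).add
    ((h.localBalance_energy ht).const_mul (4 * C0))).integral_le (A := 2 * C0 + 8 * C0 ^ 2) ht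
    (d := fun s x => ε ^ 3 * mixedD u 0 2 s x ^ 2) (by fun_prop) (fun s hs x => ?_)
    (fun s x => by positivity) (fun s x => by positivity) (fun R hR => ?_) R hR
  · refine (le_add_of_nonneg_left ?_).trans key
    exact intervalIntegral.integral_nonneg (by linarith) fun y _ => by positivity
  · have hU : mixedD u 0 0 s x ^ 2 ≤ 2 * C0 :=
      (le_mul_of_one_le_left (sq_nonneg _) hb1).trans (h.sup_bound hε hb hd hs.1 x)
    have h1 : ε * mixedD u 0 1 s x ^ 2 * mixedD u 0 0 s x ^ 2 ≤
        ε * mixedD u 0 1 s x ^ 2 * (2 * C0) := mul_le_mul_of_nonneg_left hU (by positivity)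
    have h2 := mul_nonneg hε.le
      (sq_nonneg (ε * mixedD u 0 2 s x - 2 * (mixedD u 0 0 s x * mixedD u 0 1 s x)))
    linarith
  · have i := fun {f : ℝ → ℝ → ℝ} (hf : Continuous (fun p : ℝ × ℝ => f p.1 p.2)) =>
      intervalIntegrable_of_continuous_uncurry hf 0 (-R) R
    rw [intervalIntegral.integral_add
        (i (f := fun s x => ε ^ 2 * (mixedD u 0 1 s x ^ 2
          + b ^ 2 * mixedD u 0 2 s x ^ 2 + (b ^ 2) ^ 2 * mixedD u 0 3 s x ^ 2)) (by fun_prop))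
        (i (f := fun s x => 4 * C0 * (mixedD u 0 0 s x ^ 2 + b ^ 2 * mixedD u 0 1 s x ^ 2
          + (b ^ 2) ^ 2 * mixedD u 0 2 s x ^ 2)) (by fun_prop)),
      intervalIntegral.integral_const_mul (4 * C0)]
    have h2 := h.gradient_initial hε hβ hd R hR
    have h3 := mul_le_mul_of_nonneg_left (h.energy_initial hε hβ hd R hR)
      (by positivity : 0 ≤ 4 * C0)
    linarith

/-- Dissipation bounds for the first two derivatives control their product. -/
lemma integral_abs_mul_le {f g : ℝ → ℝ → ℝ} {ε t A B : ℝ} (hε : 0 < ε) (ht : 0 ≤ t)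
    (hf : Continuous (fun p : ℝ × ℝ => f p.1 p.2)) (hg : Continuous (fun p : ℝ × ℝ => g p.1 p.2))
    {R : ℝ} (hR : 0 ≤ R)
    (hA : ∫ s in (0 : ℝ)..t, ∫ x in (-R)..R, ε * f s x ^ 2 ≤ A)
    (hB : ∫ s in (0 : ℝ)..t, ∫ x in (-R)..R, ε ^ 3 * g s x ^ 2 ≤ B) :
    2 * ε ^ 2 * ∫ s in (0 : ℝ)..t, ∫ x in (-R)..R, |f s x| * |g s x| ≤ A + B := by
  have cA : Continuous (fun p : ℝ × ℝ => ε * f p.1 p.2 ^ 2) := by fun_prop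
  have cB : Continuous (fun p : ℝ × ℝ => ε ^ 3 * g p.1 p.2 ^ 2) := by fun_prop
  have cP : Continuous (fun p : ℝ × ℝ => 2 * ε ^ 2 * (|f p.1 p.2| * |g p.1 p.2|)) := by fun_prop
  have iA := continuous_intervalIntegral_snd (f := fun s x => ε * f s x ^ 2) cA (-R) R
  have iB := continuous_intervalIntegral_snd (f := fun s x => ε ^ 3 * g s x ^ 2) cB (-R) R
  have iP := continuous_intervalIntegral_snd
    (f := fun s x => 2 * ε ^ 2 * (|f s x| * |g s x|)) cP (-R) R
  refine le_trans ?_ (add_le_add hA hB)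
  rw [← intervalIntegral.integral_add (iA.intervalIntegrable _ _) (iB.intervalIntegrable _ _),
    ← intervalIntegral.integral_const_mul]
  simp only [← intervalIntegral.integral_const_mul (2 * ε ^ 2)]
  refine intervalIntegral.integral_mono_on ht (iP.intervalIntegrable _ _)
    ((iA.add iB).intervalIntegrable _ _) fun s _ => ?_
  have jA := intervalIntegrable_of_continuous_uncurry (f := fun s x => ε * f s x ^ 2) cA s (-R) R
  have jB := intervalIntegrable_of_continuous_uncurry
    (f := fun s x => ε ^ 3 * g s x ^ 2) cB s (-R) R
  have jP := intervalIntegrable_of_continuous_uncurry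
    (f := fun s x => 2 * ε ^ 2 * (|f s x| * |g s x|)) cP s (-R) R
  rw [← intervalIntegral.integral_add jA jB]
  refine intervalIntegral.integral_mono_on (by linarith) jP (jA.add jB) fun x _ => ?_
  have h1 := mul_nonneg hε.le (sq_nonneg (|f s x| - ε * |g s x|))
  have h2 := sq_abs (f s x)
  have h3 := sq_abs (g s x)
  rw [← h2, ← h3]
  linarith

end Bounds

/-- Mixed product bound for the Rosenau–KdV–RLW approximation (★). -/
theorem ux_uxx_product_bound_KdVRLW (C0 : ℝ) (hC0 : 0 < C0) :
    ∃ D : ℝ, 0 < D ∧ ∃ C : ℝ, 0 < C ∧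
      ∀ ε β : ℝ, 0 < ε → 0 < β → β ≤ D ^ 2 * ε ^ 4 →
        ∀ u : ℝ → ℝ → ℝ, IsAdmissibleKdVRLW ε β u →
          DataBoundsKdVRLW ε β C0 (u 0) →
          ∀ t > (0 : ℝ),
            β * (∫ s in (0 : ℝ)..t, ∫ x : ℝ, |mixedD u 0 1 s x| * |mixedD u 0 2 s x|)
              ≤ C * ε ^ 2 := by
  obtain ⟨D, hD, hD2, hCD⟩ : ∃ D : ℝ, 0 < D ∧ D ≤ 1 / 2 ∧ 72 * C0 * D ≤ 1 / 4 := by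
    refine ⟨1 / (2 + 288 * C0), by positivity, ?_, ?_⟩
    · exact one_div_le_one_div_of_le (by norm_num) (by linarith)
    · rw [mul_one_div, div_le_iff₀ (by positivity)]
      linarith
  set B := 12 * C0 + 8 * C0 ^ 2 with hB
  refine ⟨D, hD, D ^ 2 * (C0 + B) / 2, by positivity, ?_⟩
  intro ε β hε hβ hβD u h hd t ht
  obtain ⟨b, hb, rfl⟩ : ∃ b : ℝ, 0 < b ∧ β = b ^ 2 :=
    ⟨√β, Real.sqrt_pos.2 hβ, (Real.sq_sqrt hβ.le).symm⟩
  have hbD : b ≤ D * ε ^ 2 :=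
    le_of_sq_le_sq (by linarith [hβD]) (by positivity)
  have c01 := continuous_mixedD h.smooth 0 1
  have c02 := continuous_mixedD h.smooth 0 2
  have hfirst : ∀ R ≥ (0 : ℝ),
      ∫ s in (0 : ℝ)..t, ∫ x in (-R)..R, ε * mixedD u 0 1 s x ^ 2 ≤ C0 := by
    intro R hR
    have h1 := h.energy_bound hε hβ hd ht R hR
    have h2 : 0 ≤ ∫ x in (-R)..R, (mixedD u 0 0 t x ^ 2 + b ^ 2 * mixedD u 0 1 t x ^ 2
        + (b ^ 2) ^ 2 * mixedD u 0 2 t x ^ 2) :=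
      intervalIntegral.integral_nonneg (by linarith) fun x _ => by positivity
    simp only [intervalIntegral.integral_const_mul] at h1 ⊢
    linarith
  have hsecond : ∀ R ≥ (0 : ℝ),
      ∫ s in (0 : ℝ)..t, ∫ x in (-R)..R, ε ^ 3 * mixedD u 0 2 s x ^ 2 ≤ B := by
    intro R hR
    rcases le_total b 1 with hb1 | hb1
    · have h1 := h.secondDeriv_bound_of_le_one hε hb hb1 hbD hD2 hC0.le hCD hd ht R hR
      simp only [intervalIntegral.integral_const_mul] at h1 ⊢
      linarith [sq_nonneg C0]
    · linarith [h.secondDeriv_bound_of_one_le hε hb1 hC0.le hd ht R hR]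
  have hmain : ∫ s in (0 : ℝ)..t, ∫ x : ℝ, |mixedD u 0 1 s x| * |mixedD u 0 2 s x|
      ≤ (C0 + B) / (2 * ε ^ 2) := by
    refine integral_integral_le_of_truncations ht.le (by positivity) (by fun_prop)
      (fun s x => by positivity) (fun s hs => ?_) fun R hR => ?_
    · have i1 := h.integrable_sq hs.1 1 (by norm_num)
      have i2 := h.integrable_sq hs.1 2 (by norm_num)
      refine (i1.add i2).mono' (Continuous.aestronglyMeasurable ?_)
        (Filter.Eventually.of_forall fun x => ?_)
      · exact ((c01.comp (Continuous.prodMk_right s)).abs).mul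
          ((c02.comp (Continuous.prodMk_right s)).abs)
      · rw [Real.norm_of_nonneg (by positivity), Pi.add_apply, ← sq_abs (mixedD u 0 1 s x),
          ← sq_abs (mixedD u 0 2 s x)]
        nlinarith [sq_nonneg (|mixedD u 0 1 s x| - |mixedD u 0 2 s x|),
          sq_nonneg (|mixedD u 0 1 s x|), sq_nonneg (|mixedD u 0 2 s x|)]
    · rw [le_div_iff₀ (by positivity), mul_comm]
      exact integral_abs_mul_le hε ht.le c01 c02 hR (hfirst R hR) (hsecond R hR)
  calc b ^ 2 * ∫ s in (0 : ℝ)..t, ∫ x : ℝ, |mixedD u 0 1 s x| * |mixedD u 0 2 s x|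
      ≤ D ^ 2 * ε ^ 4 * ((C0 + B) / (2 * ε ^ 2)) :=
        (mul_le_mul_of_nonneg_left hmain hβ.le).trans
          (mul_le_mul_of_nonneg_right hβD (by positivity))
    _ = D ^ 2 * (C0 + B) / 2 * ε ^ 2 := by field_simp

end
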